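/- Fix positive integers t ≤ m ≤ n, let X be an m×n matrix of indeterminates over a field 𝔽 of prime characteristic p, R = 𝔽[X], and I_t the ideal of t×t minors of X. Then for every integer k with 0 ≤ k ≤ t−1, the F-pure threshold of I_t satisfies fpt(I_t) ≤ (m−k)(n−k)/(t−k). -/

import Mathlib

open MvPolynomial


/-- The bracket power `J^{[q]}`: the ideal generated by the `q`-th powers of the
elements of `J`. -/
noncomputable def bracketPow {R : Type*} [CommRing R] (J : Ideal R) (q : ℕ) : Ideal R :=
  Ideal.span ((fun a => a ^ q) '' (J : Set R))

/-- The homogeneous maximal ideal `𝔪` of a polynomial ring, generated by the variables. -/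
noncomputable def maxIdl (𝔽 : Type*) [Field 𝔽] (σ : Type*) : Ideal (MvPolynomial σ 𝔽) :=
  Ideal.span (Set.range MvPolynomial.X)

/-- `ν_I(q) = max { r ∈ ℕ | I^r ⊄ 𝔪^{[q]} }`. -/
noncomputable def nu {𝔽 σ : Type*} [Field 𝔽] (I : Ideal (MvPolynomial σ 𝔽)) (q : ℕ) : ℕ :=
  sSup {r : ℕ | ¬ I ^ r ≤ bracketPow (maxIdl 𝔽 σ) q}


/-- The generic `m × n` matrix `X`, whose entries are the variables `x_{ij}` of the
polynomial ring `𝔽[X]`. -/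
noncomputable def genMat (𝔽 : Type*) [Field 𝔽] (m n : ℕ) :
    Matrix (Fin m) (Fin n) (MvPolynomial (Fin m × Fin n) 𝔽) :=
  Matrix.of fun i j => MvPolynomial.X (i, j)

/-- `f` is a size `s` minor of the generic `m × n` matrix: the determinant of the submatrix
obtained by choosing `s` rows and `s` columns (in increasing order). -/
def IsMinor (𝔽 : Type*) [Field 𝔽] (m n s : ℕ) (f : MvPolynomial (Fin m × Fin n) 𝔽) : Prop :=
  ∃ (row : Fin s → Fin m) (col : Fin s → Fin n), StrictMono row ∧ StrictMono col ∧
    f = ((genMat 𝔽 m n).submatrix row col).det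

/-- `I_s ⊆ 𝔽[X]`, the ideal generated by the size `s` minors of the generic matrix. -/
noncomputable def minorsIdeal (𝔽 : Type*) [Field 𝔽] (m n s : ℕ) :
    Ideal (MvPolynomial (Fin m × Fin n) 𝔽) :=
  Ideal.span {f | IsMinor 𝔽 m n s f}

/-- A sum of an `n × n` matrix with entries in `W` and a product factoring through rank `#κ`
has determinant in `W ^ (n - #κ)`. -/
theorem Matrix.det_add_mul_mem_pow {S ι κ : Type*} [CommRing S] [Fintype ι] [DecidableEq ι]
    [Fintype κ] [DecidableEq κ] {W : Ideal S} {V : Matrix ι ι S} (hV : ∀ i j, V i j ∈ W)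
    (Y : Matrix ι κ S) (Z : Matrix κ ι S) :
    (V + Y * Z).det ∈ W ^ (Fintype.card ι - Fintype.card κ) := by
  have h : V + Y * Z = V - Y * (-Z) := by simp
  rw [h, ← Matrix.det_fromBlocks_one₂₂, Matrix.det_apply']
  refine Ideal.sum_mem _ fun σ _ => Ideal.mul_mem_left _ _ ?_
  rw [Fintype.prod_sum_type]
  refine Ideal.mul_mem_right _ _ ?_
  rw [← Finset.prod_filter_mul_prod_filter_not Finset.univ
    (fun i : ι => (σ (Sum.inl i)).isLeft = true)]
  refine Ideal.mul_mem_right _ _ ?_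
  have hcard : Fintype.card ι - Fintype.card κ ≤
      (Finset.univ.filter fun i : ι => (σ (Sum.inl i)).isLeft = true).card := by
    have h1 := Finset.card_filter_add_card_filter_not (s := (Finset.univ : Finset ι))
      (fun i : ι => (σ (Sum.inl i)).isLeft = true)
    have h2 : (Finset.univ.filter fun i : ι => ¬ (σ (Sum.inl i)).isLeft = true).card ≤
        ((Finset.univ : Finset κ).map ⟨Sum.inr, Sum.inr_injective⟩ : Finset (ι ⊕ κ)).card := by
      refine Finset.card_le_card_of_injOn (fun i => σ (Sum.inl i)) ?_ ?_
      · intro i hi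
        rcases hσ : σ (Sum.inl i) with a | b
        · simp [hσ] at hi
        · simp [hσ]
      · intro i _ j _ hij
        exact Sum.inl_injective (σ.injective hij)
    rw [Finset.card_map, Finset.card_univ] at h2
    rw [Finset.card_univ] at h1
    omega
  refine Ideal.pow_le_pow_right hcard ?_
  rw [← Finset.prod_const]
  refine Ideal.prod_mem_prod fun i hi => ?_
  rcases hσ : σ (Sum.inl i) with a | b
  · simpa using hV a i
  · simp [hσ] at hi

theorem Ideal.sup_pow_add_le {S : Type*} [CommRing S] (I J : Ideal S) (a b : ℕ) :
    (I ⊔ J) ^ (a + b) ≤ I ^ a ⊔ J ^ b := by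
  rw [← Ideal.add_eq_sup, add_pow, Ideal.sum_eq_sup]
  refine Finset.sup_le fun i _ => Ideal.mul_le_left.trans ?_
  rcases le_total a i with h | h
  · have h' : I ^ i ≤ I ^ a := Ideal.pow_le_pow_right h
    exact Ideal.mul_le_left.trans (h'.trans le_sup_left)
  · have h' : J ^ (a + b - i) ≤ J ^ b := Ideal.pow_le_pow_right (by omega)
    exact Ideal.mul_le_right.trans (h'.trans le_sup_right)

theorem Ideal.span_image_pow_le {S ι : Type*} [CommRing S] (w : ι → S) (q : ℕ) (s : Finset ι) :
    Ideal.span (w '' s) ^ (s.card * q + 1) ≤ Ideal.span ((fun i => w i ^ q) '' s) := by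
  classical
  induction s using Finset.induction_on with
  | empty => simp
  | insert a s ha ih =>
    rw [Finset.card_insert_of_notMem ha, Finset.coe_insert, Set.image_insert_eq,
      Set.image_insert_eq, Ideal.span_insert, Ideal.span_insert,
      show (s.card + 1) * q + 1 = q + (s.card * q + 1) by ring]
    refine (Ideal.sup_pow_add_le _ _ _ _).trans (sup_le_sup ?_ ih)
    rw [Ideal.span_singleton_pow]

theorem Ideal.span_range_pow_le {S ι : Type*} [CommRing S] [Fintype ι] (w : ι → S) (q : ℕ) :
    Ideal.span (Set.range w) ^ (Fintype.card ι * q + 1) ≤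
      Ideal.span (Set.range fun i => w i ^ q) := by
  simpa using Ideal.span_image_pow_le w q Finset.univ

/-- The linear operator extracting from `f` the coefficient of `x ^ α` in the
decomposition of the polynomial ring as a free module over its subring of polynomials
in the `x_i ^ q`. -/
noncomputable def MvPolynomial.residuePart (R : Type*) {σ : Type*} [CommRing R] [Finite σ]
    (q : ℕ) (α : σ →₀ ℕ) : MvPolynomial σ R →ₗ[R] MvPolynomial σ R :=
  open Classical in
  (basisMonomials σ R).constr R fun d =>
    if ∀ i, d i % q = α i then monomial (d.mapRange (· / q) (Nat.zero_div q)) 1 else 0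

section ResiduePart

variable {R σ : Type*} [CommRing R] [Finite σ]

open Classical in
theorem MvPolynomial.residuePart_monomial (q : ℕ) (α d : σ →₀ ℕ) (c : R) :
    residuePart R q α (monomial d c) =
      if ∀ i, d i % q = α i then monomial (d.mapRange (· / q) (Nat.zero_div q)) c else 0 := by
  have h : monomial d c = c • basisMonomials σ R d := by
    simp [coe_basisMonomials, smul_monomial]
  rw [h, map_smul, residuePart, Module.Basis.constr_basis]
  split_ifs <;> simp [smul_monomial]

theorem MvPolynomial.residuePart_expand_mul {q : ℕ} (hq : 0 < q) (α : σ →₀ ℕ)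
    (a f : MvPolynomial σ R) :
    residuePart R q α (expand q a * f) = a * residuePart R q α f := by
  classical
  induction a using MvPolynomial.induction_on' with
  | add a b ha hb => rw [map_add, add_mul, map_add, ha, hb, add_mul]
  | monomial γ c =>
    induction f using MvPolynomial.induction_on' with
    | add f g hf hg => rw [mul_add, map_add, hf, hg, map_add, mul_add]
    | monomial δ e =>
      rw [expand_monomial, monomial_mul, residuePart_monomial, residuePart_monomial]
      have hiff : (∀ i, (q • γ + δ) i % q = α i) ↔ ∀ i, δ i % q = α i := by simp
      by_cases h : ∀ i, δ i % q = α i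
      · rw [if_pos (hiff.2 h), if_pos h, monomial_mul]
        congr 2
        ext i
        simp [Nat.mul_add_div hq]
      · rw [if_neg (hiff.not.2 h), if_neg h, mul_zero]

theorem MvPolynomial.constantCoeff_residuePart {q : ℕ} (hq : 0 < q) {α : σ →₀ ℕ}
    (hα : ∀ i, α i < q) (f : MvPolynomial σ R) :
    constantCoeff (residuePart R q α f) = coeff α f := by
  classical
  induction f using MvPolynomial.induction_on' with
  | add f g hf hg => rw [map_add, map_add, hf, hg, coeff_add]
  | monomial d c =>
    rw [residuePart_monomial, coeff_monomial]
    by_cases h : d = α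
    · subst h
      rw [if_pos fun i => Nat.mod_eq_of_lt (hα i), if_pos rfl, constantCoeff_monomial, if_pos]
      ext i
      simpa using Nat.div_eq_of_lt (hα i)
    · rw [if_neg h]
      split_ifs with h'
      · rw [constantCoeff_monomial, if_neg]
        refine fun h0 => h (Finsupp.ext fun i => ?_)
        have h1 : d i / q = 0 := by simpa using DFunLike.congr_fun h0 i
        rw [← h' i, Nat.mod_eq_of_lt (Nat.lt_of_div_eq_zero hq h1)]
      · simp

end ResiduePart

section Bracket

variable {𝔽 σ : Type*} [Field 𝔽] {p : ℕ} [CharP 𝔽 p]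

theorem mem_bracketPow_maxIdl_iff (hp : p.Prime) (e : ℕ) {f : MvPolynomial σ 𝔽} :
    f ∈ bracketPow (maxIdl 𝔽 σ) (p ^ e) ↔ ∀ d ∈ f.support, ∃ i, p ^ e ≤ d i := by
  have := Fact.mk hp
  have h : bracketPow (maxIdl 𝔽 σ) (p ^ e) = Ideal.span ((fun s => monomial s (1 : 𝔽)) ''
      Set.range fun i => Finsupp.single i (p ^ e)) := by
    rw [← Set.range_comp]
    have hX : (fun s => monomial s (1 : 𝔽)) ∘ (fun i : σ => Finsupp.single i (p ^ e)) =
        fun i => X i ^ p ^ e := by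
      ext1 i
      simp [X_pow_eq_monomial]
    rw [hX]
    apply le_antisymm
    · rw [bracketPow, Ideal.span_le]
      rintro _ ⟨a, ha, rfl⟩
      have hle : maxIdl 𝔽 σ ≤ (Ideal.span (Set.range fun i : σ =>
          (X i : MvPolynomial σ 𝔽) ^ p ^ e)).comap
            (iterateFrobenius (MvPolynomial σ 𝔽) p e) := by
        rw [maxIdl, Ideal.span_le]
        rintro _ ⟨i, rfl⟩
        exact Ideal.subset_span ⟨i, rfl⟩
      exact hle ha
    · rw [Ideal.span_le]
      rintro _ ⟨i, rfl⟩
      exact Ideal.subset_span ⟨X i, Ideal.subset_span ⟨i, rfl⟩, rfl⟩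
  rw [h, mem_ideal_span_monomial_image]
  simp

theorem pow_notMem_bracketPow (hp : p.Prime) (e : ℕ) {f : MvPolynomial σ 𝔽}
    (hf : f ∉ bracketPow (maxIdl 𝔽 σ) (p ^ e)) :
    f ^ p ∉ bracketPow (maxIdl 𝔽 σ) (p ^ (e + 1)) := by
  have := Fact.mk hp
  rw [mem_bracketPow_maxIdl_iff hp] at hf ⊢
  push Not at hf ⊢
  obtain ⟨d, hd, hlt⟩ := hf
  refine ⟨p • d, ?_, fun i => ?_⟩
  · have hfrob : (map (frobenius 𝔽 p)).comp (expand p : _ →ₐ[𝔽] MvPolynomial σ 𝔽).toRingHom =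
        frobenius (MvPolynomial σ 𝔽) p :=
      MvPolynomial.ringHom_ext (fun a => by simp [frobenius_def]) fun i => by simp [frobenius_def]
    have hfp : f ^ p = map (frobenius 𝔽 p) (expand p f) := (RingHom.congr_fun hfrob f).symm
    rw [hfp, mem_support_iff, coeff_map, coeff_expand_smul _ hp.ne_zero]
    simpa [frobenius_def, hp.ne_zero] using hd
  · rw [pow_succ']
    simpa using Nat.mul_lt_mul_of_pos_left (hlt i) hp.pos

end Bracket

/-- The difference between `det A • M`, where `A` is the top left `k × k` block of `M`,
and a product factoring through rank `k`. -/
def Matrix.schurDefect {S : Type*} [CommRing S] {m n k : ℕ} (hm : k ≤ m) (hn : k ≤ n)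
    (M : Matrix (Fin m) (Fin n) S) : Matrix (Fin m) (Fin n) S :=
  (M.submatrix (Fin.castLE hm) (Fin.castLE hn)).det • M -
    M.submatrix id (Fin.castLE hn) *
      ((M.submatrix (Fin.castLE hm) (Fin.castLE hn)).adjugate * M.submatrix (Fin.castLE hm) id)

section SchurDefect

variable {S T : Type*} [CommRing S] [CommRing T] {m n k : ℕ} (hm : k ≤ m) (hn : k ≤ n)
  (M : Matrix (Fin m) (Fin n) S)

theorem Matrix.map_schurDefect (g : S →+* T) :
    (M.schurDefect hm hn).map g = (M.map g).schurDefect hm hn := by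
  have h := RingHom.map_adjugate g (M.submatrix (Fin.castLE hm) (Fin.castLE hn))
  have h' := RingHom.map_det g (M.submatrix (Fin.castLE hm) (Fin.castLE hn))
  simp only [RingHom.mapMatrix_apply] at h h'
  rw [schurDefect, schurDefect, Matrix.map_sub, Matrix.map_mul, Matrix.map_mul, h]
  · ext i j
    simp [h', Matrix.submatrix_map]
  · simp

theorem Matrix.schurDefect_castLE_left (c : Fin k) (j : Fin n) :
    M.schurDefect hm hn (Fin.castLE hm c) j = 0 := by
  set A := M.submatrix (Fin.castLE hm) (Fin.castLE hn) with hA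
  have h : (M.schurDefect hm hn).submatrix (Fin.castLE hm) id = 0 := by
    change A.det • M.submatrix (Fin.castLE hm) id -
      A * (A.adjugate * M.submatrix (Fin.castLE hm) id) = 0
    rw [← Matrix.mul_assoc, Matrix.mul_adjugate, Matrix.smul_mul, Matrix.one_mul, sub_self]
  exact congrFun (congrFun h c) j

theorem Matrix.schurDefect_castLE_right (i : Fin m) (c : Fin k) :
    M.schurDefect hm hn i (Fin.castLE hn c) = 0 := by
  set A := M.submatrix (Fin.castLE hm) (Fin.castLE hn) with hA
  have h : (M.schurDefect hm hn).submatrix id (Fin.castLE hn) = 0 := by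
    change A.det • M.submatrix id (Fin.castLE hn) -
      M.submatrix id (Fin.castLE hn) * (A.adjugate * A) = 0
    rw [Matrix.adjugate_mul, Matrix.mul_smul, Matrix.mul_one, sub_self]
  exact congrFun (congrFun h i) c

/-- The entries of `Matrix.schurDefect` outside the first `k` rows and columns. -/
def Matrix.schurEntry (x : Fin (m - k) × Fin (n - k)) : S :=
  M.schurDefect hm hn ⟨k + x.1, by omega⟩ ⟨k + x.2, by omega⟩

theorem Matrix.schurDefect_mem_span (i : Fin m) (j : Fin n) :
    M.schurDefect hm hn i j ∈ Ideal.span (Set.range (M.schurEntry hm hn)) := by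
  by_cases hi : (i : ℕ) < k
  · rw [show i = Fin.castLE hm ⟨i, hi⟩ from rfl, schurDefect_castLE_left]
    exact zero_mem _
  by_cases hj : (j : ℕ) < k
  · rw [show j = Fin.castLE hn ⟨j, hj⟩ from rfl, schurDefect_castLE_right]
    exact zero_mem _
  refine Ideal.subset_span ⟨(⟨i - k, by omega⟩, ⟨j - k, by omega⟩), ?_⟩
  unfold schurEntry
  congr 1 <;> ext <;> simp <;> omega

theorem Matrix.det_pow_mul_det_submatrix_mem {t : ℕ} (row : Fin t → Fin m) (col : Fin t → Fin n) :
    (M.submatrix (Fin.castLE hm) (Fin.castLE hn)).det ^ t * (M.submatrix row col).det ∈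
      Ideal.span (Set.range (M.schurEntry hm hn)) ^ (t - k) := by
  set A := M.submatrix (Fin.castLE hm) (Fin.castLE hn) with hA
  have h : A.det • M.submatrix row col = (M.schurDefect hm hn).submatrix row col +
      M.submatrix row (Fin.castLE hn) * (A.adjugate * M.submatrix (Fin.castLE hm) col) := by
    change _ = (A.det • M.submatrix row col -
      M.submatrix row (Fin.castLE hn) * (A.adjugate * M.submatrix (Fin.castLE hm) col)) + _
    rw [sub_add_cancel]
  have h' := Matrix.det_smul (M.submatrix row col) A.det
  rw [Fintype.card_fin] at h'
  rw [← h', h]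
  simpa using Matrix.det_add_mul_mem_pow
    (V := (M.schurDefect hm hn).submatrix row col)
    (fun i j => M.schurDefect_mem_span hm hn (row i) (col j)) (M.submatrix row (Fin.castLE hn))
    (A.adjugate * M.submatrix (Fin.castLE hm) col)

end SchurDefect

section Determinantal

variable {𝔽 : Type*} [Field 𝔽] {p m n t k : ℕ} [CharP 𝔽 p]

theorem constantCoeff_eq_zero_of_det_pow_mul_mem (hm : k ≤ m) (hn : k ≤ n) (N : ℕ)
    {g : MvPolynomial (Fin m × Fin n) 𝔽}
    (hg : ((genMat 𝔽 m n).submatrix (Fin.castLE hm) (Fin.castLE hn)).det ^ N * g ∈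
      Ideal.span (Set.range ((genMat 𝔽 m n).schurEntry hm hn))) :
    constantCoeff g = 0 := by
  let E : Matrix (Fin m) (Fin n) (Polynomial 𝔽) :=
    Matrix.of fun i j => if (i : ℕ) = j ∧ (i : ℕ) < k then Polynomial.X else 0
  let φ : MvPolynomial (Fin m × Fin n) 𝔽 →ₐ[𝔽] Polynomial 𝔽 := aeval fun x => E x.1 x.2
  have hφ : (genMat 𝔽 m n).map (φ : _ →+* Polynomial 𝔽) = E := by
    ext1 i j
    simp [genMat, φ]
  have hE : E.submatrix (Fin.castLE hm) (Fin.castLE hn) =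
      (Polynomial.X : Polynomial 𝔽) • (1 : Matrix (Fin k) (Fin k) _) := by
    ext1 i j
    simp [E, Matrix.one_apply, Fin.ext_iff]
  have hdet : φ ((genMat 𝔽 m n).submatrix (Fin.castLE hm) (Fin.castLE hn)).det =
      Polynomial.X ^ k := by
    have h := RingHom.map_det (φ : _ →+* Polynomial 𝔽)
      ((genMat 𝔽 m n).submatrix (Fin.castLE hm) (Fin.castLE hn))
    rw [RingHom.mapMatrix_apply, ← Matrix.submatrix_map, hφ, hE, Matrix.det_smul] at h
    simpa using h
  have hle : Ideal.span (Set.range ((genMat 𝔽 m n).schurEntry hm hn)) ≤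
      RingHom.ker (φ : _ →+* Polynomial 𝔽) := by
    rw [Ideal.span_le]
    rintro _ ⟨x, rfl⟩
    have h := congrFun (congrFun ((genMat 𝔽 m n).map_schurDefect hm hn
      (φ : _ →+* Polynomial 𝔽)) ⟨k + x.1, by omega⟩) ⟨k + x.2, by omega⟩
    rw [hφ] at h
    refine (RingHom.mem_ker).2 (h.trans ?_)
    simp [Matrix.schurDefect, Matrix.mul_apply, E]
  have hφg : φ g = 0 := by
    have h : φ _ = 0 := hle hg
    rw [map_mul, map_pow, hdet] at h
    simpa [Polynomial.X_ne_zero] using h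
  have hc : (Polynomial.constantCoeff.comp φ.toRingHom) = constantCoeff := by
    refine MvPolynomial.ringHom_ext (fun a => ?_) fun x => ?_
    · simp [φ]
    · have hx : (E x.1 x.2).coeff 0 = 0 := by
        simp only [E, Matrix.of_apply]
        split_ifs <;> simp
      simpa [φ] using hx
  rw [← hc]
  simp [hφg]

theorem span_det_pow_mul_minorsIdeal_le (hm : k ≤ m) (hn : k ≤ n) :
    Ideal.span {((genMat 𝔽 m n).submatrix (Fin.castLE hm) (Fin.castLE hn)).det ^ t} *
        minorsIdeal 𝔽 m n t ≤
      Ideal.span (Set.range ((genMat 𝔽 m n).schurEntry hm hn)) ^ (t - k) := by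
  rw [minorsIdeal, Ideal.span_mul_span', Ideal.span_le]
  rintro _ ⟨_, rfl, _, ⟨row, col, -, -, rfl⟩, rfl⟩
  exact Matrix.det_pow_mul_det_submatrix_mem hm hn _ row col

theorem minorsIdeal_pow_le (hp : p.Prime) (hm : k ≤ m) (hn : k ≤ n) (e r : ℕ)
    (hr : (m - k) * (n - k) * p ^ e < (t - k) * r) :
    minorsIdeal 𝔽 m n t ^ r ≤ bracketPow (maxIdl 𝔽 (Fin m × Fin n)) (p ^ e) := by
  have := Fact.mk hp
  intro f hf
  have hq : 0 < p ^ e := pow_pos hp.pos e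
  set M := genMat 𝔽 m n with hM
  set u := (M.submatrix (Fin.castLE hm) (Fin.castLE hn)).det with hu
  set w := M.schurEntry hm hn with hw
  have hexp : M.map (expand (p ^ e) : _ →ₐ[𝔽] _).toRingHom =
      M.map (iterateFrobenius (MvPolynomial (Fin m × Fin n) 𝔽) p e) := by
    ext1 i j
    simp [hM, genMat, iterateFrobenius_def]
  have hexpw : ∀ x, expand (p ^ e) (w x) = w x ^ p ^ e := by
    intro x
    have h := M.map_schurDefect hm hn (expand (p ^ e) : _ →ₐ[𝔽] _).toRingHom
    rw [hexp, ← Matrix.map_schurDefect] at h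
    exact congrFun (congrFun h _) _
  have hexpu : expand (p ^ e) u = u ^ p ^ e := by
    have h := RingHom.map_det (expand (p ^ e) : _ →ₐ[𝔽] _).toRingHom
      (M.submatrix (Fin.castLE hm) (Fin.castLE hn))
    rw [RingHom.mapMatrix_apply, ← Matrix.submatrix_map, hexp, Matrix.submatrix_map,
      ← RingHom.mapMatrix_apply, ← RingHom.map_det] at h
    exact h
  have hmem : (u ^ t) ^ r * f ∈ Ideal.span (Set.range fun x => w x ^ p ^ e) := by
    have h1 : (u ^ t) ^ r * f ∈ (Ideal.span {u ^ t} * minorsIdeal 𝔽 m n t) ^ r := by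
      rw [mul_pow]
      exact Ideal.mul_mem_mul (Ideal.pow_mem_pow (Ideal.mem_span_singleton_self _) r) hf
    have h2 := Ideal.pow_right_mono (span_det_pow_mul_minorsIdeal_le hm hn) r h1
    rw [← pow_mul] at h2
    have h3 := Ideal.span_range_pow_le w (p ^ e)
    rw [Fintype.card_prod, Fintype.card_fin, Fintype.card_fin] at h3
    exact h3 (Ideal.pow_le_pow_right hr h2)
  have hmem' : expand (p ^ e) (u ^ (t * r)) * f ∈
      Ideal.span (Set.range fun x => w x ^ p ^ e) := by
    have h : expand (p ^ e) (u ^ (t * r)) * f =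
        (u ^ (t * r)) ^ (p ^ e - 1) * ((u ^ t) ^ r * f) := by
      rw [map_pow, hexpu, ← pow_mul u t r, ← mul_assoc, ← pow_succ,
        Nat.sub_add_cancel hq, pow_right_comm]
    rw [h]
    exact Ideal.mul_mem_left _ _ hmem
  rw [mem_bracketPow_maxIdl_iff hp]
  by_contra! hcon
  obtain ⟨α, hα, hlt⟩ := hcon
  refine mem_support_iff.1 hα ?_
  rw [← constantCoeff_residuePart hq hlt]
  refine constantCoeff_eq_zero_of_det_pow_mul_mem hm hn (t * r) ?_
  rw [← residuePart_expand_mul hq]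
  generalize expand (p ^ e) (u ^ (t * r)) * f = g at hmem'
  obtain ⟨c, hc⟩ := (Ideal.mem_span_range_iff_exists_fun).1 hmem'
  rw [← hc, map_sum]
  refine Ideal.sum_mem _ fun x _ => ?_
  rw [mul_comm, ← hexpw, residuePart_expand_mul hq]
  exact Ideal.mul_mem_right _ _ (Ideal.subset_span ⟨x, rfl⟩)

end Determinantal

/-- For every `k` with `0 ≤ k ≤ t-1`, the `F`-pure threshold of the determinantal ideal
`I_t` (the limit of `ν_{I_t}(p^e)/p^e`) satisfies `fpt(I_t) ≤ (m-k)(n-k)/(t-k)`. -/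
theorem fpt_determinantal_le (p : ℕ) (hp : p.Prime) (𝔽 : Type*) [Field 𝔽] [CharP 𝔽 p]
    (m n t : ℕ) (ht : 0 < t) (htm : t ≤ m) (hmn : m ≤ n)
    (k : ℕ) (hk : k ≤ t - 1) :
    ∃ fpt : ℝ,
      Filter.Tendsto (fun e : ℕ => (nu (minorsIdeal 𝔽 m n t) (p ^ e) : ℝ) / (p ^ e : ℕ))
        Filter.atTop (nhds fpt) ∧
      fpt ≤ (((m - k) * (n - k) : ℕ) : ℝ) / ((t - k : ℕ) : ℝ) := by
  have hkt : k < t := by omega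
  have hkm : k ≤ m := by omega
  have hkn : k ≤ n := by omega
  have hbound : ∀ e, ∀ r ∈ {r : ℕ | ¬ minorsIdeal 𝔽 m n t ^ r ≤
      bracketPow (maxIdl 𝔽 (Fin m × Fin n)) (p ^ e)},
      (t - k) * r ≤ (m - k) * (n - k) * p ^ e := fun e r hr => by
    by_contra! h
    exact hr (minorsIdeal_pow_le hp hkm hkn e r h)
  have hbdd : ∀ e, BddAbove {r : ℕ | ¬ minorsIdeal 𝔽 m n t ^ r ≤
      bracketPow (maxIdl 𝔽 (Fin m × Fin n)) (p ^ e)} := fun e =>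
    ⟨(m - k) * (n - k) * p ^ e, fun r hr =>
      (Nat.le_mul_of_pos_left r (by omega)).trans (hbound e r hr)⟩
  have hnonempty : ∀ e, {r : ℕ | ¬ minorsIdeal 𝔽 m n t ^ r ≤
      bracketPow (maxIdl 𝔽 (Fin m × Fin n)) (p ^ e)}.Nonempty := fun e => by
    refine ⟨0, fun h => ?_⟩
    have h1 : (1 : MvPolynomial (Fin m × Fin n) 𝔽) ∈
        bracketPow (maxIdl 𝔽 (Fin m × Fin n)) (p ^ e) := h (by simp)
    obtain ⟨i, hi⟩ := (mem_bracketPow_maxIdl_iff hp e).1 h1 0 (by simp)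
    exact (pow_pos hp.pos e).not_ge hi
  have hmem := fun e => Nat.sSup_mem (hnonempty e) (hbdd e)
  have hmono : Monotone fun e : ℕ => (nu (minorsIdeal 𝔽 m n t) (p ^ e) : ℝ) / (p ^ e : ℕ) := by
    refine monotone_nat_of_le_succ fun e => ?_
    have hp0 : (0 : ℝ) < p := by exact_mod_cast hp.pos
    have hle : p * nu (minorsIdeal 𝔽 m n t) (p ^ e) ≤
        nu (minorsIdeal 𝔽 m n t) (p ^ (e + 1)) := by
      refine le_csSup (hbdd (e + 1)) fun hcon => ?_
      obtain ⟨f, hf, hfn⟩ := SetLike.not_le_iff_exists.1 (hmem e)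
      refine pow_notMem_bracketPow hp e hfn (hcon ?_)
      rw [mul_comm, pow_mul]
      exact Ideal.pow_mem_pow hf p
    have hle' : (p : ℝ) * nu (minorsIdeal 𝔽 m n t) (p ^ e) ≤
        nu (minorsIdeal 𝔽 m n t) (p ^ (e + 1)) := by exact_mod_cast hle
    push_cast
    rw [div_le_div_iff₀ (by positivity) (by positivity), pow_succ (p : ℝ)]
    linarith [mul_le_mul_of_nonneg_right hle' (pow_pos hp0 e).le]
  have hupper : ∀ e, (nu (minorsIdeal 𝔽 m n t) (p ^ e) : ℝ) / (p ^ e : ℕ) ≤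
      (((m - k) * (n - k) : ℕ) : ℝ) / ((t - k : ℕ) : ℝ) := fun e => by
    have h1 : (0 : ℝ) < (p ^ e : ℕ) := by exact_mod_cast pow_pos hp.pos e
    have h2 : (0 : ℝ) < (t - k : ℕ) := by exact_mod_cast Nat.sub_pos_of_lt hkt
    rw [div_le_div_iff₀ h1 h2, mul_comm]
    exact_mod_cast hbound e _ (hmem e)
  exact ⟨_, tendsto_atTop_ciSup hmono ⟨_, Set.forall_mem_range.2 hupper⟩, ciSup_le hupper⟩
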